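/- Let a > 0 and T > 0. There exists a constant C = C(a,T) > 0 such that for every m > 0, every U ∈ (0,T], and every continuously differentiable G : (0,U] → ℝ with G and G' bounded, ∫₀^U | G(s)·(3/(2s) − m²/(2as²)) − G'(s) | · p_{m,a}(s) ds ≤ C · (sup_{0<s≤U}|G(s)| + sup_{0<s≤U}|G'(s)|) / m², where p_{m,a}(s) := (m/√(2πas³)) exp(−m²/(2as)). -/

import Mathlib

open MeasureTheory

/-- The Lévy density with parameters `m` (distance) and `a` (diffusion coefficient). -/
noncomputable def levyDensity (m a s : ℝ) : ℝ :=
  m / Real.sqrt (2 * Real.pi * a * s ^ 3) * Real.exp (-m ^ 2 / (2 * a * s))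

open Real Set

/-- The inverse-gamma integrand `s ^ (-(q + 1)) * exp (-(b / s))`, as it arises from the gamma
integrand under the substitution `y = s⁻¹`. -/
theorem abs_mul_rpow_smul_comp_inv_eq {q b s : ℝ} (hs : 0 < s) :
    (|(-1 : ℝ)| * s ^ ((-1 : ℝ) - 1)) •
        ((s ^ (-1 : ℝ)) ^ (q - 1) * exp (-(b * s ^ (-1 : ℝ)))) =
      s ^ (-(q + 1)) * exp (-(b / s)) := by
  rw [← rpow_mul hs.le, smul_eq_mul, abs_neg, abs_one, one_mul, ← mul_assoc, ← rpow_add hs,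
    rpow_neg_one, div_eq_mul_inv]
  ring_nf

theorem integrableOn_rpow_mul_exp_neg_div {q b : ℝ} (hq : 0 < q) (hb : 0 < b) :
    IntegrableOn (fun s : ℝ => s ^ (-(q + 1)) * exp (-(b / s))) (Ioi 0) := by
  have hgamma : IntegrableOn (fun y : ℝ => y ^ (q - 1) * exp (-(b * y))) (Ioi 0) := by
    simpa using integrableOn_rpow_mul_exp_neg_mul_rpow (s := q - 1) (p := 1) (by linarith)
      one_pos hb
  refine ((integrableOn_Ioi_comp_rpow_iff _ (p := -1) (by norm_num)).2 hgamma).congr_fun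
    (fun s hs => abs_mul_rpow_smul_comp_inv_eq hs) measurableSet_Ioi

theorem integral_rpow_mul_exp_neg_div {q b : ℝ} (hq : 0 < q) (hb : 0 < b) :
    ∫ s in Ioi (0 : ℝ), s ^ (-(q + 1)) * exp (-(b / s)) = (1 / b) ^ q * Gamma q := by
  rw [← integral_rpow_mul_exp_neg_mul_Ioi hq hb,
    ← integral_comp_rpow_Ioi (fun y => y ^ (q - 1) * exp (-(b * y))) (p := -1) (by norm_num)]
  exact setIntegral_congr_fun measurableSet_Ioi
    fun s hs => (abs_mul_rpow_smul_comp_inv_eq hs).symm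

theorem levyDensity_eq_rpow {m a s : ℝ} (ha : 0 < a) (hs : 0 < s) :
    levyDensity m a s =
      m / √(2 * π * a) * (s ^ (-(3 / 2) : ℝ) * exp (-(m ^ 2 / (2 * a) / s))) := by
  have hsqrt : √(s ^ 3) = s ^ (3 / 2 : ℝ) := by
    rw [sqrt_eq_rpow, ← rpow_natCast, ← rpow_mul hs.le]
    norm_num
  rw [levyDensity, sqrt_mul (by positivity), hsqrt, rpow_neg hs.le]
  have hexp : -m ^ 2 / (2 * a * s) = -(m ^ 2 / (2 * a) / s) := by
    field_simp
  rw [hexp]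
  field_simp

theorem levyDensity_nonneg {m a s : ℝ} (hm : 0 ≤ m) : 0 ≤ levyDensity m a s := by
  unfold levyDensity
  positivity

theorem levyDensity_mul_rpow_neg {m a s : ℝ} (ha : 0 < a) (hs : 0 < s) (r : ℝ) :
    s ^ (-r) * levyDensity m a s =
      m / √(2 * π * a) * (s ^ (-(r + 1 / 2 + 1)) * exp (-(m ^ 2 / (2 * a) / s))) := by
  rw [levyDensity_eq_rpow ha hs, show -(r + 1 / 2 + 1) = -r + (-(3 / 2) : ℝ) by ring,
    rpow_add hs]
  ring

theorem integrableOn_rpow_neg_mul_levyDensity {m a r : ℝ} (hm : 0 < m) (ha : 0 < a)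
    (hr : 0 ≤ r) :
    IntegrableOn (fun s => s ^ (-r) * levyDensity m a s) (Ioi 0) := by
  refine IntegrableOn.congr_fun ?_ (fun s hs => (levyDensity_mul_rpow_neg ha hs r).symm)
    measurableSet_Ioi
  exact (integrableOn_rpow_mul_exp_neg_div (by linarith) (by positivity)).const_mul _

/-- The negative moments of the Lévy distribution. -/
theorem integral_rpow_neg_mul_levyDensity {m a r : ℝ} (hm : 0 < m) (ha : 0 < a) (hr : 0 ≤ r) :
    ∫ s in Ioi (0 : ℝ), s ^ (-r) * levyDensity m a s =
      (2 * a / m ^ 2) ^ r * (Gamma (r + 1 / 2) / √π) := by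
  rw [setIntegral_congr_fun measurableSet_Ioi fun s hs => levyDensity_mul_rpow_neg ha hs r,
    integral_const_mul, integral_rpow_mul_exp_neg_div (by linarith) (by positivity),
    one_div_div, rpow_add (by positivity), ← sqrt_eq_rpow, sqrt_div (by positivity),
    sqrt_sq hm.le, show 2 * π * a = 2 * a * π by ring, sqrt_mul (by positivity)]
  have : √(2 * a) ≠ 0 := by positivity
  field_simp

theorem abs_weight_mul_le {g g' s c T A B p : ℝ} (hs : 0 < s) (hsT : s ≤ T) (hc : 0 ≤ c)
    (hp : 0 ≤ p) (hg : |g| ≤ A) (hg' : |g'| ≤ B) :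
    |g * (3 / (2 * s) - c / s ^ 2) - g'| * p ≤
      (A + B) * ((3 / 2 + T) * (s ^ (-1 : ℝ) * p) + c * (s ^ (-2 : ℝ) * p)) := by
  have hA : 0 ≤ A := (abs_nonneg g).trans hg
  have hB : 0 ≤ B := (abs_nonneg g').trans hg'
  have hT : 1 ≤ T * s⁻¹ := by
    rw [← div_eq_mul_inv]
    exact (one_le_div hs).2 hsT
  have hweight : |3 / (2 * s) - c / s ^ 2| ≤ 3 / (2 * s) + c / s ^ 2 := by
    refine (abs_sub _ _).trans_eq ?_
    rw [abs_of_nonneg (by positivity), abs_of_nonneg (by positivity)]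
  have hrpow : s ^ (-2 : ℝ) = (s ^ 2)⁻¹ := by
    rw [rpow_neg hs.le]
    norm_cast
  rw [rpow_neg_one, hrpow]
  have key : |g * (3 / (2 * s) - c / s ^ 2) - g'| ≤
      (A + B) * ((3 / 2 + T) * s⁻¹ + c * (s ^ 2)⁻¹) := by
    calc |g * (3 / (2 * s) - c / s ^ 2) - g'|
        ≤ |g| * |3 / (2 * s) - c / s ^ 2| + |g'| := by
          rw [← abs_mul]
          exact abs_sub _ _
      _ ≤ A * (3 / (2 * s) + c / s ^ 2) + B * (T * s⁻¹) := by
          gcongr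
          exact hg'.trans (le_mul_of_one_le_right hB hT)
      _ = A * (3 / 2 * s⁻¹ + c * (s ^ 2)⁻¹) + B * (T * s⁻¹) := by
          field_simp
      _ ≤ (A + B) * ((3 / 2 + T) * s⁻¹ + c * (s ^ 2)⁻¹) := by
          have h₁ : 0 ≤ A * (T * s⁻¹) := mul_nonneg hA (zero_le_one.trans hT)
          have h₂ : 0 ≤ B * (3 / 2 * s⁻¹ + c * (s ^ 2)⁻¹) := by positivity
          linarith
  calc _ ≤ (A + B) * ((3 / 2 + T) * s⁻¹ + c * (s ^ 2)⁻¹) * p := by gcongr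
    _ = _ := by ring

/-- space degeneration estimate for the integration by parts weight
with respect to the Lévy density on the last interval. -/
theorem stmt_11 (a T : ℝ) (ha : 0 < a) (hT : 0 < T) :
    ∃ C > 0, ∀ m : ℝ, 0 < m → ∀ U : ℝ, 0 < U → U ≤ T →
      ∀ G G' : ℝ → ℝ,
        (∀ s ∈ Set.Ioc 0 U, HasDerivWithinAt G (G' s) (Set.Ioc 0 U) s) →
        ContinuousOn G' (Set.Ioc 0 U) →
        (∃ K, ∀ s ∈ Set.Ioc 0 U, |G s| ≤ K ∧ |G' s| ≤ K) →
        ∫ s in Set.Ioc (0 : ℝ) U,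
            |G s * (3 / (2 * s) - m ^ 2 / (2 * a * s ^ 2)) - G' s| * levyDensity m a s
          ≤ C * ((⨆ s : Set.Ioc (0 : ℝ) U, |G s.1|)
              + ⨆ s : Set.Ioc (0 : ℝ) U, |G' s.1|) / m ^ 2 := by
  refine ⟨2 * a * ((3 / 2 + T) * (Gamma (1 + 1 / 2) / √π) + Gamma (2 + 1 / 2) / √π), ?_, ?_⟩
  · have h₁ : 0 < Gamma (1 + 1 / 2) := Gamma_pos_of_pos (by norm_num)
    have h₂ : 0 < Gamma (2 + 1 / 2) := Gamma_pos_of_pos (by norm_num)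
    positivity
  intro m hm U hU hUT G G' _ _ ⟨K, hK⟩
  set A := ⨆ s : Ioc (0 : ℝ) U, |G s.1|
  set B := ⨆ s : Ioc (0 : ℝ) U, |G' s.1|
  have hA : ∀ s ∈ Ioc 0 U, |G s| ≤ A := fun s hs =>
    le_ciSup (f := fun s : Ioc (0 : ℝ) U => |G s.1|)
      ⟨K, forall_mem_range.2 fun s => (hK s.1 s.2).1⟩ ⟨s, hs⟩
  have hB : ∀ s ∈ Ioc 0 U, |G' s| ≤ B := fun s hs =>
    le_ciSup (f := fun s : Ioc (0 : ℝ) U => |G' s.1|)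
      ⟨K, forall_mem_range.2 fun s => (hK s.1 s.2).2⟩ ⟨s, hs⟩
  have hAB : 0 ≤ A + B :=
    add_nonneg (iSup_nonneg fun _ => abs_nonneg _) (iSup_nonneg fun _ => abs_nonneg _)
  have hp : ∀ s, 0 ≤ levyDensity m a s := fun s => levyDensity_nonneg hm.le
  set F : ℝ → ℝ := fun s => (A + B) * ((3 / 2 + T) * (s ^ (-1 : ℝ) * levyDensity m a s) +
    m ^ 2 / (2 * a) * (s ^ (-2 : ℝ) * levyDensity m a s)) with hF
  have hint₁ := (integrableOn_rpow_neg_mul_levyDensity hm ha zero_le_one).const_mul (3 / 2 + T)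
  have hint₂ := (integrableOn_rpow_neg_mul_levyDensity hm ha zero_le_two).const_mul
    (m ^ 2 / (2 * a))
  have hFint : IntegrableOn F (Ioi 0) := (hint₁.add hint₂).const_mul _
  have hFval : ∫ s in Ioi 0, F s =
      2 * a * ((3 / 2 + T) * (Gamma (1 + 1 / 2) / √π) + Gamma (2 + 1 / 2) / √π) *
        (A + B) / m ^ 2 := by
    rw [hF, integral_const_mul, integral_add hint₁ hint₂, integral_const_mul,
      integral_const_mul, integral_rpow_neg_mul_levyDensity hm ha zero_le_one,
      integral_rpow_neg_mul_levyDensity hm ha zero_le_two, rpow_one, rpow_two]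
    field_simp
  calc _ ≤ ∫ s in Ioc 0 U, F s := by
        refine integral_mono_of_nonneg
          (Filter.Eventually.of_forall fun s => mul_nonneg (abs_nonneg _) (hp s))
          (hFint.mono_set Ioc_subset_Ioi_self)
          (ae_restrict_of_forall_mem measurableSet_Ioc fun s hs => ?_)
        have := abs_weight_mul_le (c := m ^ 2 / (2 * a)) hs.1 (hs.2.trans hUT) (by positivity)
          (hp s) (hA s hs) (hB s hs)
        rwa [div_div] at this
    _ ≤ ∫ s in Ioi 0, F s := by
        refine setIntegral_mono_set hFint
          (ae_restrict_of_forall_mem measurableSet_Ioi fun s hs => ?_)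
          Ioc_subset_Ioi_self.eventuallyLE
        have hs' : 0 < s := hs
        have := hp s
        simp only [hF, Pi.zero_apply]
        positivity
    _ = _ := hFval
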